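/- arXiv:0902.2181 — 2 statements merged into one kernel-verified Lean document; each statement's English description precedes it below -/
import Mathlib

section
/- Let n ≥ 1, 1 ≤ k ≤ n−1. Let B (resp. B⁻) denote the subgroup of GL_n(ℂ) consisting of invertible upper (resp. lower) triangular matrices. For a permutation u ∈ S_n let M_u denote its permutation matrix, with (M_u)_{ij} = δ_{i,u(j)}. Let V₀ ⊆ ℂⁿ be the span of the first k standard basis vectors, and for g ∈ GL_n(ℂ) let q(g) denote the subspace g(V₀). Let ℓ(u) denote the number of inversions of u (the Coxeter length), let W_P = {u ∈ S_n : u maps {1,…,k} onto {1,…,k}}, and call v ∈ S_n a maximal-length coset representative if ℓ(v u) ≤ ℓ(v) for all u ∈ W_P. For v, w ∈ S_n set R_{v,w} = { q(g) : g ∈ (B⁻ M_v B) ∩ (B M_w B) } (a set of k-dimensional subspaces of ℂⁿ). Let c = (1 2 … n) be the long cycle in S_n. Then: for every v, w ∈ S_n such that v is a maximal-length coset representative and R_{v,w} is nonempty, there exist v′, w′ ∈ S_n with v′ a maximal-length coset representative and R_{v′,w′} nonempty, such that { M_c · V : V ∈ R_{v,w} } = R_{v′,w′}. In other words, the action of the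 permutation matrix of the Coxeter element c on the Grassmannian Gr(k,n) permutes the strata of the Lusztig stratification. -/
open Matrix

noncomputable section

/-- The permutation matrix `M_u ∈ GL_n(ℂ)` of `u ∈ Sₙ`, with `(M_u)_{ij} = δ_{i, u(j)}`. -/
def permMatrix (n : ℕ) (u : Equiv.Perm (Fin n)) : Matrix (Fin n) (Fin n) ℂ :=
  fun i j => if i = u j then 1 else 0

/-- `B`: the invertible upper triangular `n × n` complex matrices. -/
def upperBorel (n : ℕ) : Set (Matrix (Fin n) (Fin n) ℂ) :=
  {g | IsUnit g ∧ ∀ i j : Fin n, j < i → g i j = 0}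

/-- `B⁻`: the invertible lower triangular `n × n` complex matrices. -/
def lowerBorel (n : ℕ) : Set (Matrix (Fin n) (Fin n) ℂ) :=
  {g | IsUnit g ∧ ∀ i j : Fin n, i < j → g i j = 0}

/-- The double coset `A · x · B = {a * x * b : a ∈ A, b ∈ B}`. -/
def doubleCoset (n : ℕ) (A : Set (Matrix (Fin n) (Fin n) ℂ))
    (x : Matrix (Fin n) (Fin n) ℂ) (B : Set (Matrix (Fin n) (Fin n) ℂ)) :
    Set (Matrix (Fin n) (Fin n) ℂ) :=
  {y | ∃ a ∈ A, ∃ b ∈ B, y = a * x * b}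

/-- `V₀ ⊆ ℂⁿ`: the span of the first `k` standard basis vectors. -/
def firstCoords (n k : ℕ) : Submodule ℂ (Fin n → ℂ) :=
  Submodule.span ℂ {v : Fin n → ℂ | ∃ i : Fin n, (i : ℕ) < k ∧ v = Pi.single i 1}

/-- `q(g) = g(V₀)`: the point of the Grassmannian `Gr(k,n)` attached to `g`. -/
def grassPoint (n k : ℕ) (g : Matrix (Fin n) (Fin n) ℂ) : Submodule ℂ (Fin n → ℂ) :=
  (firstCoords n k).map g.mulVecLin

/-- `ℓ(u)`: the number of inversions (Coxeter length) of `u ∈ Sₙ`. -/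
def numInversions (n : ℕ) (u : Equiv.Perm (Fin n)) : ℕ :=
  (Finset.univ.filter fun p : Fin n × Fin n => p.1 < p.2 ∧ u p.2 < u p.1).card

/-- Membership in the parabolic subgroup `W_P = S_k × S_{n−k}`: `u` maps `{1,…,k}`
onto `{1,…,k}` (0-based: `{i : i < k}` onto itself). -/
def inParabolic (n k : ℕ) (u : Equiv.Perm (Fin n)) : Prop :=
  ∀ i : Fin n, ((u i : ℕ) < k ↔ (i : ℕ) < k)

/-- `v` is a maximal-length representative of its coset `v W_P`:
`ℓ(v u) ≤ ℓ(v)` for all `u ∈ W_P`. -/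
def isMaxLengthRep (n k : ℕ) (v : Equiv.Perm (Fin n)) : Prop :=
  ∀ u : Equiv.Perm (Fin n), inParabolic n k u →
    numInversions n (v * u) ≤ numInversions n v

/-- The Lusztig stratum `R_{v,w} = q((B⁻ · M_v · B) ∩ (B · M_w · B))`, a set of
`k`-dimensional subspaces of `ℂⁿ`. -/
def lusztigStratum (n k : ℕ) (v w : Equiv.Perm (Fin n)) :
    Set (Submodule ℂ (Fin n → ℂ)) :=
  {V | ∃ g ∈ doubleCoset n (lowerBorel n) (permMatrix n v) (upperBorel n) ∩
          doubleCoset n (upperBorel n) (permMatrix n w) (upperBorel n),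
        V = grassPoint n k g}

/-- The indices `i < c`. -/
def lowSet (n c : ℕ) : Set (Fin n) := {i | (i : ℕ) < c}

/-- The indices `i ≥ a`. -/
def highSet (n a : ℕ) : Set (Fin n) := {i | a ≤ (i : ℕ)}

/-- The coordinate subspace of vectors supported on `S`. -/
def coordSubspace {n : ℕ} (S : Set (Fin n)) : Submodule ℂ (Fin n → ℂ) where
  carrier := {x | ∀ i ∉ S, x i = 0}
  add_mem' := by
    intro x y hx hy i hi
    simp [hx i hi, hy i hi]
  zero_mem' := by
    intro i _
    rfl
  smul_mem' := by
    intro r x hx i hi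
    simp [hx i hi]

theorem mem_coordSubspace {n : ℕ} {S : Set (Fin n)} {x : Fin n → ℂ} :
    x ∈ coordSubspace S ↔ ∀ i ∉ S, x i = 0 := Iff.rfl

theorem coordSubspace_inf {n : ℕ} (S T : Set (Fin n)) :
    coordSubspace S ⊓ coordSubspace T = coordSubspace (S ∩ T) := by
  ext x
  simp only [Submodule.mem_inf, mem_coordSubspace, Set.mem_inter_iff]
  grind

theorem coordSubspace_mono {n : ℕ} {S T : Set (Fin n)} (h : S ⊆ T) :
    coordSubspace S ≤ coordSubspace T :=
  fun _ hx i hi => hx i fun hS => hi (h hS)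

theorem coordSubspace_sup {n : ℕ} (S T : Set (Fin n)) :
    coordSubspace S ⊔ coordSubspace T = coordSubspace (S ∪ T) := by
  classical
  refine le_antisymm (sup_le (coordSubspace_mono Set.subset_union_left)
    (coordSubspace_mono Set.subset_union_right)) fun x hx => ?_
  refine Submodule.mem_sup.2 ⟨fun i => if i ∈ S then x i else 0, fun i hi => if_neg hi,
    fun i => if i ∈ S then 0 else x i, fun i hi => ?_, ?_⟩
  · by_cases hS : i ∈ S
    · exact if_pos hS
    · simpa [hS] using hx i (by simp [hS, hi])
  · ext i
    by_cases hS : i ∈ S <;> simp [hS]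

theorem coordSubspace_eq_span {n : ℕ} (S : Set (Fin n)) :
    coordSubspace S = Submodule.span ℂ ((fun i : Fin n => (Pi.single i 1 : Fin n → ℂ)) '' S) := by
  refine le_antisymm (fun x hx => ?_) (Submodule.span_le.2 ?_)
  · rw [pi_eq_sum_univ' x]
    refine Submodule.sum_mem _ fun i _ => ?_
    by_cases hS : i ∈ S
    · refine Submodule.smul_mem _ _ (Submodule.subset_span ⟨i, hS, ?_⟩)
      ext j
      simp [Pi.single_apply, eq_comm]
    · simp [hx i hS]
  · rintro _ ⟨i, hi, rfl⟩ j hj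
    exact Pi.single_eq_of_ne (by rintro rfl; exact hj hi) _

theorem finrank_coordSubspace {n : ℕ} (S : Set (Fin n)) :
    Module.finrank ℂ (coordSubspace S) = S.ncard := by
  classical
  have hli : LinearIndependent ℂ (fun i : Fin n => (Pi.single i 1 : Fin n → ℂ)) := by
    convert (Pi.basisFun ℂ (Fin n)).linearIndependent using 1
    ext1 i
    exact (Pi.basisFun_apply ℂ (Fin n) i).symm
  have : Fintype S := Fintype.ofFinite S
  have := finrank_span_eq_card (hli.comp (fun i : S => (i : Fin n)) Subtype.val_injective)
  rw [coordSubspace_eq_span, Set.image_eq_range]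
  refine this.trans ?_
  rw [← Nat.card_eq_fintype_card, Nat.card_coe_set_eq]

theorem firstCoords_eq (n k : ℕ) : firstCoords n k = coordSubspace (lowSet n k) := by
  rw [coordSubspace_eq_span, firstCoords]
  congr 1
  ext x
  simp [lowSet, eq_comm]

/-! ### Permutation matrices -/

theorem permMatrix_mul_apply {n : ℕ} (u : Equiv.Perm (Fin n)) (A : Matrix (Fin n) (Fin n) ℂ)
    (i j : Fin n) : (permMatrix n u * A) i j = A (u⁻¹ i) j := by
  rw [Matrix.mul_apply, Finset.sum_eq_single (u⁻¹ i)]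
  · simp [permMatrix]
  · intro b _ hb
    have : i ≠ u b := fun h => hb (by simp [h])
    simp [permMatrix, this]
  · simp

theorem mul_permMatrix_apply {n : ℕ} (u : Equiv.Perm (Fin n)) (A : Matrix (Fin n) (Fin n) ℂ)
    (i j : Fin n) : (A * permMatrix n u) i j = A i (u j) := by
  simp [Matrix.mul_apply, permMatrix]

theorem permMatrix_mul {n : ℕ} (u v : Equiv.Perm (Fin n)) :
    permMatrix n u * permMatrix n v = permMatrix n (u * v) := by
  ext i j
  rw [permMatrix_mul_apply]
  simp only [permMatrix, Equiv.Perm.inv_eq_iff_eq, Equiv.Perm.mul_apply]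
  congr

theorem permMatrix_one (n : ℕ) : permMatrix n 1 = 1 := by
  ext i j
  simp only [permMatrix, Matrix.one_apply, Equiv.Perm.one_apply]
  congr

theorem isUnit_permMatrix {n : ℕ} (u : Equiv.Perm (Fin n)) : IsUnit (permMatrix n u) :=
  ⟨⟨permMatrix n u, permMatrix n u⁻¹, by simp [permMatrix_mul, permMatrix_one],
    by simp [permMatrix_mul, permMatrix_one]⟩, rfl⟩

theorem permMatrix_mulVec {n : ℕ} (u : Equiv.Perm (Fin n)) (x : Fin n → ℂ) (i : Fin n) :
    (permMatrix n u *ᵥ x) i = x (u⁻¹ i) := by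
  rw [Matrix.mulVec, dotProduct, Finset.sum_eq_single (u⁻¹ i)]
  · simp [permMatrix]
  · intro b _ hb
    have : i ≠ u b := fun h => hb (by simp [h])
    simp [permMatrix, this]
  · simp

theorem map_permMatrix_coordSubspace {n : ℕ} (u : Equiv.Perm (Fin n)) (S : Set (Fin n)) :
    (coordSubspace S).map (permMatrix n u).mulVecLin = coordSubspace (u '' S) := by
  ext x
  simp only [Submodule.mem_map, Matrix.mulVecLin_apply]
  constructor
  · rintro ⟨y, hy, rfl⟩ i hi
    rw [permMatrix_mulVec]
    exact hy _ fun h => hi ⟨_, h, by simp⟩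
  · intro hx
    refine ⟨fun i => x (u i), fun i hi => hx _ ?_, ?_⟩
    · rintro ⟨j, hj, h⟩
      exact hi (u.injective h ▸ hj)
    · ext i
      rw [permMatrix_mulVec]
      simp

/-! ### Triangular matrices and coordinate flags -/

theorem mulVecLin_injective {n : ℕ} {g : Matrix (Fin n) (Fin n) ℂ} (hg : IsUnit g) :
    Function.Injective g.mulVecLin :=
  Matrix.mulVec_injective_of_isUnit hg

theorem map_mulVecLin_mul {n : ℕ} (A B : Matrix (Fin n) (Fin n) ℂ) (V : Submodule ℂ (Fin n → ℂ)) :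
    V.map (A * B).mulVecLin = (V.map B.mulVecLin).map A.mulVecLin := by
  rw [Matrix.mulVecLin_mul, Submodule.map_comp]

theorem finrank_map_of_isUnit {n : ℕ} {g : Matrix (Fin n) (Fin n) ℂ} (hg : IsUnit g)
    (V : Submodule ℂ (Fin n → ℂ)) :
    Module.finrank ℂ (V.map g.mulVecLin) = Module.finrank ℂ V :=
  (Submodule.equivMapOfInjective _ (mulVecLin_injective hg) V).finrank_eq.symm

theorem map_coordSubspace_of_isUnit {n : ℕ} {g : Matrix (Fin n) (Fin n) ℂ} (hg : IsUnit g)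
    {S : Set (Fin n)} (h : ∀ i ∉ S, ∀ j ∈ S, g i j = 0) :
    (coordSubspace S).map g.mulVecLin = coordSubspace S := by
  refine Submodule.eq_of_le_of_finrank_eq ?_ (finrank_map_of_isUnit hg _)
  rintro _ ⟨x, hx, rfl⟩ i hi
  rw [Matrix.mulVecLin_apply, Matrix.mulVec, dotProduct]
  refine Finset.sum_eq_zero fun j _ => ?_
  by_cases hj : j ∈ S
  · rw [h i hi j hj, zero_mul]
  · rw [hx j hj, mul_zero]

theorem map_upperBorel_low {n : ℕ} {b : Matrix (Fin n) (Fin n) ℂ} (hb : b ∈ upperBorel n)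
    (c : ℕ) : (coordSubspace (lowSet n c)).map b.mulVecLin = coordSubspace (lowSet n c) := by
  refine map_coordSubspace_of_isUnit hb.1 fun i hi j hj => hb.2 i j ?_
  simp only [lowSet, Set.mem_ofPred_eq] at hi hj
  omega

theorem map_lowerBorel_high {n : ℕ} {b : Matrix (Fin n) (Fin n) ℂ} (hb : b ∈ lowerBorel n)
    (a : ℕ) : (coordSubspace (highSet n a)).map b.mulVecLin = coordSubspace (highSet n a) := by
  refine map_coordSubspace_of_isUnit hb.1 fun i hi j hj => hb.2 i j ?_
  simp only [highSet, Set.mem_ofPred_eq] at hi hj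
  omega

theorem map_low_of_mem_doubleCoset {n : ℕ} {A : Set (Matrix (Fin n) (Fin n) ℂ)}
    {u : Equiv.Perm (Fin n)} {g : Matrix (Fin n) (Fin n) ℂ}
    (hg : g ∈ doubleCoset n A (permMatrix n u) (upperBorel n)) :
    ∃ a ∈ A, ∀ m, (coordSubspace (lowSet n m)).map g.mulVecLin =
      (coordSubspace (u '' lowSet n m)).map a.mulVecLin := by
  obtain ⟨a, ha, b, hb, rfl⟩ := hg
  refine ⟨a, ha, fun m => ?_⟩
  rw [map_mulVecLin_mul, map_upperBorel_low hb, map_mulVecLin_mul, map_permMatrix_coordSubspace]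

theorem finrank_map_low_inf_low {n : ℕ} {w : Equiv.Perm (Fin n)}
    {g : Matrix (Fin n) (Fin n) ℂ}
    (hg : g ∈ doubleCoset n (upperBorel n) (permMatrix n w) (upperBorel n)) (m c : ℕ) :
    Module.finrank ℂ ((coordSubspace (lowSet n m)).map g.mulVecLin ⊓
      coordSubspace (lowSet n c) : Submodule ℂ (Fin n → ℂ)) =
        {i : Fin n | (i : ℕ) < m ∧ (w i : ℕ) < c}.ncard := by
  obtain ⟨b, hb, h⟩ := map_low_of_mem_doubleCoset hg
  rw [h, ← map_upperBorel_low hb, ← Submodule.map_inf _ (mulVecLin_injective hb.1),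
    finrank_map_of_isUnit hb.1, coordSubspace_inf, finrank_coordSubspace,
    ← Set.ncard_image_of_injective {i : Fin n | (i : ℕ) < m ∧ (w i : ℕ) < c} w.injective]
  congr 1
  ext i
  simp only [lowSet, Set.mem_inter_iff, Set.mem_image, Set.mem_ofPred_eq]
  constructor
  · rintro ⟨⟨j, hj, rfl⟩, hi⟩
    exact ⟨j, ⟨hj, hi⟩, rfl⟩
  · rintro ⟨j, ⟨hj, hi⟩, rfl⟩
    exact ⟨⟨j, hj, rfl⟩, hi⟩

theorem map_low_inf_high {n : ℕ} {v : Equiv.Perm (Fin n)} {g : Matrix (Fin n) (Fin n) ℂ}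
    (hg : g ∈ doubleCoset n (lowerBorel n) (permMatrix n v) (upperBorel n)) (k a : ℕ) :
    Module.finrank ℂ ((coordSubspace (lowSet n k)).map g.mulVecLin ⊓
      coordSubspace (highSet n a) : Submodule ℂ (Fin n → ℂ)) =
        {j : Fin n | (j : ℕ) < k ∧ a ≤ (v j : ℕ)}.ncard ∧
    Module.finrank ℂ ((coordSubspace (lowSet n k)).map g.mulVecLin ⊔
      coordSubspace (highSet n a) : Submodule ℂ (Fin n → ℂ)) =
        {j : Fin n | (j : ℕ) < k ∨ a ≤ (v j : ℕ)}.ncard ∧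
    (∀ m, {j : Fin n | (j : ℕ) < k ∧ a ≤ (v j : ℕ)} = lowSet n m →
      (coordSubspace (lowSet n k)).map g.mulVecLin ⊓ coordSubspace (highSet n a) =
        (coordSubspace (lowSet n m)).map g.mulVecLin) ∧
    (∀ m, {j : Fin n | (j : ℕ) < k ∨ a ≤ (v j : ℕ)} = lowSet n m →
      (coordSubspace (lowSet n k)).map g.mulVecLin ⊔ coordSubspace (highSet n a) =
        (coordSubspace (lowSet n m)).map g.mulVecLin) := by
  obtain ⟨b, hb, h⟩ := map_low_of_mem_doubleCoset hg
  have hinf : v '' lowSet n k ∩ highSet n a =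
      v '' {j : Fin n | (j : ℕ) < k ∧ a ≤ (v j : ℕ)} := by
    ext i
    simp only [lowSet, highSet, Set.mem_inter_iff, Set.mem_image, Set.mem_ofPred_eq]
    grind
  have hsup : v '' lowSet n k ∪ highSet n a =
      v '' {j : Fin n | (j : ℕ) < k ∨ a ≤ (v j : ℕ)} := by
    ext i
    simp only [lowSet, highSet, Set.mem_union, Set.mem_image, Set.mem_ofPred_eq]
    constructor
    · rintro (⟨j, hj, rfl⟩ | hi)
      · exact ⟨j, Or.inl hj, rfl⟩
      · exact ⟨v⁻¹ i, by simp [hi], by simp⟩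
    · rintro ⟨j, hj | hj, rfl⟩
      · exact Or.inl ⟨j, hj, rfl⟩
      · exact Or.inr hj
  have hinf' : (coordSubspace (lowSet n k)).map g.mulVecLin ⊓ coordSubspace (highSet n a) =
      (coordSubspace (v '' {j : Fin n | (j : ℕ) < k ∧ a ≤ (v j : ℕ)})).map b.mulVecLin := by
    rw [h, ← map_lowerBorel_high hb, ← Submodule.map_inf _ (mulVecLin_injective hb.1),
      coordSubspace_inf, hinf]
  have hsup' : (coordSubspace (lowSet n k)).map g.mulVecLin ⊔ coordSubspace (highSet n a) =
      (coordSubspace (v '' {j : Fin n | (j : ℕ) < k ∨ a ≤ (v j : ℕ)})).map b.mulVecLin := by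
    rw [h, ← map_lowerBorel_high hb, ← Submodule.map_sup, coordSubspace_sup, hsup]
  refine ⟨?_, ?_, fun m hm => ?_, fun m hm => ?_⟩
  · rw [hinf', finrank_map_of_isUnit hb.1, finrank_coordSubspace,
      Set.ncard_image_of_injective _ v.injective]
  · rw [hsup', finrank_map_of_isUnit hb.1, finrank_coordSubspace,
      Set.ncard_image_of_injective _ v.injective]
  · rw [hinf', hm, h]
  · rw [hsup', hm, h]

/-! ### Maximal-length representatives -/

theorem numInversions_lt_mul_swap {n : ℕ} {v : Equiv.Perm (Fin n)} {i j : Fin n}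
    (hij : (i : ℕ) + 1 = j) (h : v i < v j) :
    numInversions n v < numInversions n (v * Equiv.swap i j) := by
  classical
  set s := Equiv.swap i j with hs
  have hlt : i < j := by rw [Fin.lt_def]; omega
  have hmono : ∀ p q : Fin n, p < q → ¬ (p = i ∧ q = j) → s p < s q := by
    intro p q hpq hne
    simp only [hs, Equiv.swap_apply_def, Fin.lt_def, Fin.ext_iff] at *
    grind
  unfold numInversions
  rw [← Finset.card_map (s.prodCongr s).toEmbedding]
  refine Finset.card_lt_card (Finset.ssubset_iff_of_subset ?_ |>.2 ⟨(i, j), ?_, ?_⟩)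
  · intro x hx
    simp only [Finset.mem_map, Finset.mem_filter, Finset.mem_univ, true_and] at hx
    obtain ⟨⟨p, q⟩, ⟨hpq, hv⟩, rfl⟩ := hx
    have : s p < s q := hmono p q hpq (by rintro ⟨rfl, rfl⟩; exact lt_asymm h hv)
    simp only [Finset.mem_filter, Finset.mem_univ, true_and]
    exact ⟨this, by simpa [hs] using hv⟩
  · simp [hs, hlt, h]
  · simp only [Finset.mem_map, Finset.mem_filter, Finset.mem_univ, true_and]
    rintro ⟨⟨p, q⟩, ⟨hpq, hv⟩, he⟩
    simp only [Equiv.coe_toEmbedding, Equiv.prodCongr_apply, Prod.map_apply, Prod.mk.injEq] at he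
    have hp : p = j := s.injective (by rw [he.1]; simp [hs])
    have hq : q = i := s.injective (by rw [he.2]; simp [hs])
    exact lt_asymm hlt (hp ▸ hq ▸ hpq)

theorem isMaxLengthRep.lt_of_lt {n k : ℕ} {v : Equiv.Perm (Fin n)} (hv : isMaxLengthRep n k v)
    {i j : Fin n} (hij : i < j) (hk : (i : ℕ) < k ↔ (j : ℕ) < k) : v j < v i := by
  have step : ∀ i j : Fin n, (i : ℕ) + 1 = j → ((i : ℕ) < k ↔ (j : ℕ) < k) → v j < v i := by
    intro i j hij hk
    by_contra hcon
    have hne : v i ≠ v j := fun h => by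
      have := v.injective h
      simp [this] at hij
    refine absurd (hv (Equiv.swap i j) fun p => ?_)
      (not_le.2 (numInversions_lt_mul_swap hij (lt_of_le_of_ne (not_lt.1 hcon) hne)))
    rw [Equiv.swap_apply_def]
    grind
  obtain ⟨d, hd⟩ : ∃ d, (j : ℕ) = i + 1 + d := Nat.exists_eq_add_of_le hij
  induction d generalizing j with
  | zero => exact step i j (by omega) hk
  | succ d ih =>
    have hj := j.isLt
    let j' : Fin n := ⟨i + 1 + d, by omega⟩
    have hj' : (j' : ℕ) = i + 1 + d := rfl
    refine (step j' j (by omega) (by omega)).trans (ih (j := j') ?_ (by omega) hj')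
    rw [Fin.lt_def]
    omega

theorem isMaxLengthRep.isLowerSet_and {n k : ℕ} {v : Equiv.Perm (Fin n)}
    (hv : isMaxLengthRep n k v) (a : ℕ) :
    IsLowerSet {j : Fin n | (j : ℕ) < k ∧ a ≤ (v j : ℕ)} := by
  rintro j i hij ⟨hj, ha⟩
  rcases hij.eq_or_lt with rfl | hlt
  · exact ⟨hj, ha⟩
  · have hlt' : (i : ℕ) < j := hlt
    have := hv.lt_of_lt hlt (by omega)
    rw [Fin.lt_def] at this
    exact ⟨by omega, by omega⟩

theorem isMaxLengthRep.isLowerSet_or {n k : ℕ} {v : Equiv.Perm (Fin n)}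
    (hv : isMaxLengthRep n k v) (a : ℕ) :
    IsLowerSet {j : Fin n | (j : ℕ) < k ∨ a ≤ (v j : ℕ)} := by
  rintro j i hij hj
  rcases hij.eq_or_lt with rfl | hlt
  · exact hj
  · have hlt' : (i : ℕ) < j := hlt
    by_cases hi : (i : ℕ) < k
    · exact Or.inl hi
    · have := hv.lt_of_lt hlt (by omega)
      rw [Fin.lt_def] at this
      simp only [Set.mem_ofPred_eq] at hj
      exact Or.inr (by omega)

theorem exists_eq_lowSet {n : ℕ} {S : Set (Fin n)} (hS : IsLowerSet S) :
    ∃ m, S = lowSet n m := by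
  classical
  have hex : ∃ m : ℕ, ∀ i ∈ S, (i : ℕ) < m := ⟨n, fun i _ => i.isLt⟩
  refine ⟨Nat.find hex, Set.Subset.antisymm (Nat.find_spec hex) fun i hi => ?_⟩
  have := Nat.find_min hex hi
  push Not at this
  obtain ⟨j, hj, hij⟩ := this
  exact hS hij hj

theorem IsLowerSet.eq_of_ncard_eq {n : ℕ} {S T : Set (Fin n)} (hS : IsLowerSet S)
    (hT : IsLowerSet T) (h : S.ncard = T.ncard) : S = T := by
  rcases hS.total hT with hST | hTS
  · exact Set.eq_of_subset_of_ncard_le hST h.ge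
  · exact (Set.eq_of_subset_of_ncard_le hTS h.le).symm

theorem exists_isMaxLengthRep_mul {n k : ℕ} (v : Equiv.Perm (Fin n)) :
    ∃ u, inParabolic n k u ∧ isMaxLengthRep n k (v * u) := by
  classical
  obtain ⟨u, hu, hmax⟩ := Finset.exists_max_image
    (Finset.univ.filter fun u : Equiv.Perm (Fin n) => inParabolic n k u)
    (fun u => numInversions n (v * u))
    ⟨1, Finset.mem_filter.2 ⟨Finset.mem_univ _, fun _ => Iff.rfl⟩⟩
  simp only [Finset.mem_filter, Finset.mem_univ, true_and] at hu hmax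
  refine ⟨u, hu, fun t ht => ?_⟩
  rw [mul_assoc]
  exact hmax _ fun i => by rw [Equiv.Perm.mul_apply, hu, ht]

/-! ### Bruhat decompositions -/

theorem mem_upperBorel_of_diag_ne_zero {n : ℕ} {b : Matrix (Fin n) (Fin n) ℂ}
    (h : ∀ i j : Fin n, j < i → b i j = 0) (hd : ∀ i, b i i ≠ 0) : b ∈ upperBorel n := by
  refine ⟨?_, h⟩
  rw [Matrix.isUnit_iff_isUnit_det, Matrix.det_of_isUpperTriangular (fun i j hij => h i j hij)]
  exact (Finset.prod_ne_zero_iff.2 fun i _ => hd i).isUnit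

theorem inv_mem_upperBorel {n : ℕ} {b : Matrix (Fin n) (Fin n) ℂ} (hb : b ∈ upperBorel n) :
    b⁻¹ ∈ upperBorel n := by
  have : Invertible b := hb.1.invertible
  refine ⟨by simpa using hb.1, fun i j hij => ?_⟩
  exact Matrix.blockTriangular_inv_of_blockTriangular (b := id) (fun i j hij => hb.2 i j hij) hij

theorem exists_mem_doubleCoset_upper {n : ℕ} {g : Matrix (Fin n) (Fin n) ℂ} (hg : IsUnit g) :
    ∃ w, g ∈ doubleCoset n (upperBorel n) (permMatrix n w) (upperBorel n) := by
  classical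
  let P : Fin n → ℕ → Prop := fun j c => ∃ y : Fin n → ℂ, y j = 1 ∧ (∀ i, j < i → y i = 0) ∧
    ∀ i : Fin n, c ≤ (i : ℕ) → (g *ᵥ y) i = 0
  have hex : ∀ j, ∃ c, P j c := fun j =>
    ⟨n, Pi.single j 1, by simp, fun i hi => Pi.single_eq_of_ne hi.ne' _,
      fun i hi => absurd i.isLt (by omega)⟩
  have hpos : ∀ j, Nat.find (hex j) ≠ 0 := by
    intro j h0
    obtain ⟨y, hy1, -, hy⟩ := Nat.find_spec (hex j)
    have hz : g *ᵥ y = g *ᵥ 0 := by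
      ext i
      simpa using hy i (by omega)
    have := Matrix.mulVec_injective_of_isUnit hg hz
    simp [this] at hy1
  have hle : ∀ j, Nat.find (hex j) ≤ n := fun j => Nat.find_min' _
    ⟨Pi.single j 1, by simp, fun i hi => Pi.single_eq_of_ne hi.ne' _,
      fun i hi => absurd i.isLt (by omega)⟩
  choose y hy1 hy2 hy3 using fun j => Nat.find_spec (hex j)
  let w₀ : Fin n → Fin n := fun j => ⟨Nat.find (hex j) - 1, by have := hpos j; have := hle j; omega⟩
  have hw₀ : ∀ j, (w₀ j : ℕ) + 1 = Nat.find (hex j) := fun j => by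
    have := hpos j
    simp only [w₀]
    omega
  have hne : ∀ j, (g *ᵥ y j) (w₀ j) ≠ 0 := by
    intro j h0
    refine Nat.find_min (hex j) (m := w₀ j) (by have := hw₀ j; omega)
      ⟨y j, hy1 j, hy2 j, fun i hi => ?_⟩
    rcases hi.eq_or_lt with h | h
    · rwa [← Fin.ext h]
    · exact hy3 j i (by have := hw₀ j; omega)
  have hinj' : ∀ i j, i < j → w₀ i ≠ w₀ j := by
    intro i j hij he
    refine Nat.find_min (hex j) (m := w₀ j) (by have := hw₀ j; omega)
      ⟨y j - ((g *ᵥ y j) (w₀ j) / (g *ᵥ y i) (w₀ j)) • y i, ?_, fun l hl => ?_, fun l hl => ?_⟩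
    · simp [hy1, hy2 i j hij]
    · simp [hy2 j l hl, hy2 i l (hij.trans hl)]
    · rw [Matrix.mulVec_sub, Matrix.mulVec_smul]
      rcases hl.eq_or_lt with h | h
      · rw [← Fin.ext h]
        have := hne i
        rw [he] at this
        simp [div_mul_cancel₀ _ this]
      · have h1 := hy3 j l (by have := hw₀ j; omega)
        have h2 := hy3 i l (by have := hw₀ i; rw [he] at this; omega)
        simp [h1, h2]
  have hinj : Function.Injective w₀ := by
    intro i j he
    rcases lt_trichotomy i j with h | h | h
    · exact absurd he (hinj' i j h)
    · exact h
    · exact absurd he.symm (hinj' j i h)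
  let w : Equiv.Perm (Fin n) := Equiv.ofBijective w₀ (Finite.injective_iff_bijective.1 hinj)
  have hw : ∀ j, w j = w₀ j := fun j => rfl
  let b : Matrix (Fin n) (Fin n) ℂ := fun i j => y j i
  have hb : b ∈ upperBorel n :=
    mem_upperBorel_of_diag_ne_zero (fun i j hij => hy2 j i hij) fun i => by simp [b, hy1]
  have hgb : ∀ i j, (g * b) i j = (g *ᵥ y j) i := fun i j => rfl
  have ha : g * b * permMatrix n w⁻¹ ∈ upperBorel n := by
    refine mem_upperBorel_of_diag_ne_zero (fun i j hij => ?_) fun i => ?_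
    · rw [mul_permMatrix_apply, hgb]
      refine hy3 _ i ?_
      rw [← hw₀, ← hw]
      simpa using hij
    · rw [mul_permMatrix_apply, hgb]
      simpa [← hw] using hne (w⁻¹ i)
  refine ⟨w, _, ha, b⁻¹, inv_mem_upperBorel hb, ?_⟩
  rw [mul_assoc (g * b), permMatrix_mul, inv_mul_cancel, permMatrix_one, mul_one, mul_assoc,
    Matrix.mul_nonsing_inv _ ((Matrix.isUnit_iff_isUnit_det _).1 hb.1), mul_one]

theorem exists_mem_doubleCoset_lower {n : ℕ} {g : Matrix (Fin n) (Fin n) ℂ} (hg : IsUnit g) :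
    ∃ v, g ∈ doubleCoset n (lowerBorel n) (permMatrix n v) (upperBorel n) := by
  let r : Equiv.Perm (Fin n) := Fin.revPerm
  have hr : permMatrix n r * permMatrix n r = 1 := by
    rw [permMatrix_mul, ← permMatrix_one]
    congr 1
    ext i
    simp [r]
  obtain ⟨w, a, ha, b, hb, h⟩ := exists_mem_doubleCoset_upper ((isUnit_permMatrix r).mul hg)
  refine ⟨r * w, permMatrix n r * a * permMatrix n r,
    ⟨((isUnit_permMatrix r).mul ha.1).mul (isUnit_permMatrix r), fun i j hij => ?_⟩, b, hb, ?_⟩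
  · rw [mul_permMatrix_apply, permMatrix_mul_apply]
    exact ha.2 _ _ (by simpa [r, Equiv.Perm.inv_def] using hij)
  · calc g = permMatrix n r * (permMatrix n r * g) := by rw [← mul_assoc, hr, one_mul]
      _ = permMatrix n r * (a * (permMatrix n r * permMatrix n r) * permMatrix n w * b) := by
        rw [h, hr, mul_one]
      _ = _ := by rw [← permMatrix_mul]; simp only [mul_assoc]

theorem one_mem_upperBorel (n : ℕ) : (1 : Matrix (Fin n) (Fin n) ℂ) ∈ upperBorel n :=
  mem_upperBorel_of_diag_ne_zero (fun _ _ h => Matrix.one_apply_ne h.ne') (by simp)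

/-- Every point of the Grassmannian lies in a stratum indexed by a maximal-length
representative. -/
theorem exists_mem_lusztigStratum {n k : ℕ} {g : Matrix (Fin n) (Fin n) ℂ} (hg : IsUnit g) :
    ∃ v w, isMaxLengthRep n k v ∧ grassPoint n k g ∈ lusztigStratum n k v w := by
  obtain ⟨v, hv⟩ := exists_mem_doubleCoset_lower hg
  obtain ⟨a, ha, h⟩ := map_low_of_mem_doubleCoset hv
  obtain ⟨u, hu, hmax⟩ := exists_isMaxLengthRep_mul (k := k) v
  obtain ⟨w, hw⟩ := exists_mem_doubleCoset_upper (ha.1.mul (isUnit_permMatrix (v * u)))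
  refine ⟨v * u, w, hmax, a * permMatrix n (v * u),
    ⟨⟨a, ha, 1, one_mem_upperBorel n, (mul_one _).symm⟩, hw⟩, ?_⟩
  rw [grassPoint, grassPoint, firstCoords_eq, h, map_mulVecLin_mul, map_permMatrix_coordSubspace]
  congr 2
  ext i
  simp only [lowSet, Set.mem_image, Set.mem_ofPred_eq, Equiv.Perm.mul_apply]
  constructor
  · rintro ⟨j, hj, rfl⟩
    exact ⟨u⁻¹ j, by rw [← hu]; simpa using hj, by simp⟩
  · rintro ⟨j, hj, rfl⟩
    exact ⟨u j, (hu j).2 hj, rfl⟩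

/-! ### Cyclic rank conditions -/

/-- The cyclic intervals of `Fin n`. -/
def cyclicIntervals (n : ℕ) : Set (Set (Fin n)) :=
  {S | ∃ a b, S = highSet n a ∩ lowSet n b ∨ S = highSet n a ∪ lowSet n b}

/-- Two subspaces meet the coordinate subspaces of all cyclic intervals in the same dimensions. -/
def SameCyclicRanks {n : ℕ} (V V' : Submodule ℂ (Fin n → ℂ)) : Prop :=
  ∀ S ∈ cyclicIntervals n,
    Module.finrank ℂ (V ⊓ coordSubspace S : Submodule ℂ (Fin n → ℂ)) =
      Module.finrank ℂ (V' ⊓ coordSubspace S : Submodule ℂ (Fin n → ℂ))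

theorem lowSet_zero (n : ℕ) : lowSet n 0 = ∅ := by simp [lowSet]

theorem highSet_zero (n : ℕ) : highSet n 0 = Set.univ := by simp [highSet]

theorem coordSubspace_univ (n : ℕ) : coordSubspace (Set.univ : Set (Fin n)) = ⊤ := by
  ext x
  simp [mem_coordSubspace]

theorem highSet_mem_cyclicIntervals (n a : ℕ) : highSet n a ∈ cyclicIntervals n :=
  ⟨a, 0, Or.inr (by simp [lowSet_zero])⟩

theorem SameCyclicRanks.finrank_eq {n : ℕ} {V V' : Submodule ℂ (Fin n → ℂ)}
    (h : SameCyclicRanks V V') : Module.finrank ℂ V = Module.finrank ℂ V' := by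
  have := h _ (highSet_mem_cyclicIntervals n 0)
  rwa [highSet_zero, coordSubspace_univ, inf_top_eq, inf_top_eq] at this

theorem SameCyclicRanks.finrank_sup_eq {n : ℕ} {V V' : Submodule ℂ (Fin n → ℂ)}
    (h : SameCyclicRanks V V') {S : Set (Fin n)} (hS : S ∈ cyclicIntervals n) :
    Module.finrank ℂ (V ⊔ coordSubspace S : Submodule ℂ (Fin n → ℂ)) =
      Module.finrank ℂ (V' ⊔ coordSubspace S : Submodule ℂ (Fin n → ℂ)) := by
  have h1 := Submodule.finrank_sup_add_finrank_inf_eq V (coordSubspace S)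
  have h2 := Submodule.finrank_sup_add_finrank_inf_eq V' (coordSubspace S)
  have h3 := h S hS
  have h4 := h.finrank_eq
  omega

theorem preimage_mem_cyclicIntervals {n : ℕ} {c : Equiv.Perm (Fin n)}
    (hc : ∀ i : Fin n, (c i : ℕ) = if (i : ℕ) + 1 < n then (i : ℕ) + 1 else 0)
    {S : Set (Fin n)} (hS : S ∈ cyclicIntervals n) : c ⁻¹' S ∈ cyclicIntervals n := by
  have hempty : (∅ : Set (Fin n)) ∈ cyclicIntervals n := ⟨0, 0, Or.inl (by simp [lowSet_zero])⟩
  have huniv : (Set.univ : Set (Fin n)) ∈ cyclicIntervals n :=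
    ⟨0, 0, Or.inr (by simp [highSet_zero])⟩
  obtain ⟨a, b, rfl | rfl⟩ := hS
  · rcases Nat.eq_zero_or_pos b with rfl | hb
    · simpa [lowSet_zero] using hempty
    rcases Nat.eq_zero_or_pos a with rfl | ha
    · refine ⟨n - 1, b - 1, Or.inr ?_⟩
      ext i
      have := hc i
      have := i.isLt
      simp only [highSet, lowSet, Set.mem_preimage, Set.mem_inter_iff, Set.mem_union,
        Set.mem_ofPred_eq]
      split_ifs at * <;> omega
    · refine ⟨a - 1, min (b - 1) (n - 1), Or.inl ?_⟩
      ext i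
      have := hc i
      have := i.isLt
      simp only [highSet, lowSet, Set.mem_preimage, Set.mem_inter_iff, Set.mem_ofPred_eq]
      split_ifs at * <;> omega
  · rcases Nat.eq_zero_or_pos a with rfl | ha
    · simpa [highSet_zero] using huniv
    rcases Nat.eq_zero_or_pos b with rfl | hb
    · refine ⟨a - 1, n - 1, Or.inl ?_⟩
      ext i
      have := hc i
      have := i.isLt
      simp only [highSet, lowSet, Set.mem_preimage, Set.mem_inter_iff, Set.mem_union,
        Set.mem_ofPred_eq]
      split_ifs at * <;> omega
    · refine ⟨min (a - 1) (n - 1), b - 1, Or.inr ?_⟩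
      ext i
      have := hc i
      have := i.isLt
      simp only [highSet, lowSet, Set.mem_preimage, Set.mem_union, Set.mem_ofPred_eq]
      split_ifs at * <;> omega

theorem preimage_inv_mem_cyclicIntervals {n : ℕ} {c : Equiv.Perm (Fin n)}
    (hc : ∀ i : Fin n, (c i : ℕ) = if (i : ℕ) + 1 < n then (i : ℕ) + 1 else 0)
    {S : Set (Fin n)} (hS : S ∈ cyclicIntervals n) : ⇑c⁻¹ ⁻¹' S ∈ cyclicIntervals n := by
  have hpow : ∀ m : ℕ, ⇑(c ^ m) ⁻¹' S ∈ cyclicIntervals n := by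
    intro m
    induction m with
    | zero => simpa using hS
    | succ m ih =>
      rw [pow_succ, Equiv.Perm.coe_mul, Set.preimage_comp]
      exact preimage_mem_cyclicIntervals hc ih
  have hinv : c⁻¹ = c ^ (orderOf c - 1) :=
    inv_eq_of_mul_eq_one_right (by
      rw [← pow_succ', Nat.sub_add_cancel (orderOf_pos c), pow_orderOf_eq_one])
  rw [hinv]
  exact hpow _

theorem SameCyclicRanks.map_permMatrix {n : ℕ} {σ : Equiv.Perm (Fin n)}
    (hσ : ∀ S ∈ cyclicIntervals n, σ ⁻¹' S ∈ cyclicIntervals n)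
    {V V' : Submodule ℂ (Fin n → ℂ)} (h : SameCyclicRanks V V') :
    SameCyclicRanks (V.map (permMatrix n σ).mulVecLin) (V'.map (permMatrix n σ).mulVecLin) := by
  intro S hS
  have key : coordSubspace S = (coordSubspace (σ ⁻¹' S)).map (permMatrix n σ).mulVecLin := by
    rw [map_permMatrix_coordSubspace, Set.image_preimage_eq _ σ.surjective]
  have hu := isUnit_permMatrix σ
  rw [key, ← Submodule.map_inf _ (mulVecLin_injective hu),
    ← Submodule.map_inf _ (mulVecLin_injective hu), finrank_map_of_isUnit hu,
    finrank_map_of_isUnit hu]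
  exact h _ (hσ S hS)

theorem sameCyclicRanks_of_mem_lusztigStratum {n k : ℕ} {v w : Equiv.Perm (Fin n)}
    (hv : isMaxLengthRep n k v) {V V' : Submodule ℂ (Fin n → ℂ)}
    (hV : V ∈ lusztigStratum n k v w) (hV' : V' ∈ lusztigStratum n k v w) :
    SameCyclicRanks V V' := by
  obtain ⟨g, ⟨hg, hgw⟩, rfl⟩ := hV
  obtain ⟨g', ⟨hg', hgw'⟩, rfl⟩ := hV'
  simp only [grassPoint, firstCoords_eq]
  rintro S ⟨a, b, rfl | rfl⟩
  · obtain ⟨m, hm⟩ := exists_eq_lowSet (hv.isLowerSet_and a)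
    rw [← coordSubspace_inf, ← inf_assoc, ← inf_assoc, (map_low_inf_high hg k a).2.2.1 m hm,
      (map_low_inf_high hg' k a).2.2.1 m hm, finrank_map_low_inf_low hgw,
      finrank_map_low_inf_low hgw']
  · obtain ⟨m, hm⟩ := exists_eq_lowSet (hv.isLowerSet_or a)
    have hdim : ∀ {g : Matrix (Fin n) (Fin n) ℂ},
        g ∈ doubleCoset n (lowerBorel n) (permMatrix n v) (upperBorel n) →
        ∀ l, Module.finrank ℂ ((coordSubspace (lowSet n l)).map g.mulVecLin) =
          (lowSet n l).ncard := by
      intro g hg l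
      obtain ⟨b, hb, h⟩ := map_low_of_mem_doubleCoset hg
      rw [h, finrank_map_of_isUnit hb.1, finrank_coordSubspace,
        Set.ncard_image_of_injective _ v.injective]
    have main : ∀ {g : Matrix (Fin n) (Fin n) ℂ},
        g ∈ doubleCoset n (lowerBorel n) (permMatrix n v) (upperBorel n) →
        g ∈ doubleCoset n (upperBorel n) (permMatrix n w) (upperBorel n) →
        Module.finrank ℂ ((coordSubspace (lowSet n k)).map g.mulVecLin ⊓
            coordSubspace (highSet n a ∪ lowSet n b) : Submodule ℂ (Fin n → ℂ)) +
          ((lowSet n m).ncard + (lowSet n b).ncard) =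
        (lowSet n k).ncard + (highSet n a ∪ lowSet n b).ncard +
          {i : Fin n | (i : ℕ) < m ∧ (w i : ℕ) < b}.ncard := by
      intro g hg hgw
      have h1 := Submodule.finrank_sup_add_finrank_inf_eq
        ((coordSubspace (lowSet n k)).map g.mulVecLin)
        (coordSubspace (highSet n a ∪ lowSet n b))
      have h2 := Submodule.finrank_sup_add_finrank_inf_eq
        ((coordSubspace (lowSet n m)).map g.mulVecLin) (coordSubspace (lowSet n b))
      have h3 : (coordSubspace (lowSet n k)).map g.mulVecLin ⊔
          coordSubspace (highSet n a ∪ lowSet n b) =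
          (coordSubspace (lowSet n m)).map g.mulVecLin ⊔ coordSubspace (lowSet n b) := by
        rw [← coordSubspace_sup, ← sup_assoc, (map_low_inf_high hg k a).2.2.2 m hm]
      rw [h3, hdim hg, finrank_coordSubspace] at h1
      rw [hdim hg, finrank_coordSubspace, finrank_map_low_inf_low hgw] at h2
      omega
    have h1 := main hg hgw
    have h2 := main hg' hgw'
    omega

theorem perm_eq_of_ncard_eq {n : ℕ} {w w' : Equiv.Perm (Fin n)}
    (h : ∀ m ≤ n, ∀ c, {i : Fin n | (i : ℕ) < m ∧ (w i : ℕ) < c}.ncard =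
      {i : Fin n | (i : ℕ) < m ∧ (w' i : ℕ) < c}.ncard) : w = w' := by
  classical
  have step : ∀ (u : Equiv.Perm (Fin n)) (j : Fin n) (c : ℕ),
      {i : Fin n | (i : ℕ) < j + 1 ∧ (u i : ℕ) < c}.ncard =
        {i : Fin n | (i : ℕ) < j ∧ (u i : ℕ) < c}.ncard + if (u j : ℕ) < c then 1 else 0 := by
    intro u j c
    split_ifs with hj
    · rw [← Set.ncard_insert_of_notMem (a := j) (by simp)]
      congr 1
      ext i
      simp only [Set.mem_ofPred_eq, Set.mem_insert_iff, Fin.ext_iff]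
      grind
    · rw [add_zero]
      congr 1
      ext i
      simp only [Set.mem_ofPred_eq]
      grind
  have key : ∀ (j : Fin n) (c : ℕ), (w j : ℕ) < c ↔ (w' j : ℕ) < c := by
    intro j c
    have h1 := h (j + 1) j.isLt c
    rw [step, step, h j j.isLt.le c] at h1
    split_ifs at h1 <;> omega
  ext j
  have h1 := key j (w j + 1)
  have h2 := key j (w' j + 1)
  omega

theorem SameCyclicRanks.perms_eq {n k : ℕ} {v w v' w' : Equiv.Perm (Fin n)}
    (hv : isMaxLengthRep n k v) (hv' : isMaxLengthRep n k v')
    {V V' : Submodule ℂ (Fin n → ℂ)} (hV : V ∈ lusztigStratum n k v w)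
    (hV' : V' ∈ lusztigStratum n k v' w') (h : SameCyclicRanks V V') : v = v' ∧ w = w' := by
  obtain ⟨g, ⟨hg, hgw⟩, rfl⟩ := hV
  obtain ⟨g', ⟨hg', hgw'⟩, rfl⟩ := hV'
  simp only [grassPoint, firstCoords_eq] at h
  have hand : ∀ a : ℕ, {j : Fin n | (j : ℕ) < k ∧ a ≤ (v j : ℕ)} =
      {j : Fin n | (j : ℕ) < k ∧ a ≤ (v' j : ℕ)} := fun a =>
    (hv.isLowerSet_and a).eq_of_ncard_eq (hv'.isLowerSet_and a) (by
      rw [← (map_low_inf_high hg k a).1, ← (map_low_inf_high hg' k a).1]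
      exact h _ (highSet_mem_cyclicIntervals n a))
  have hor : ∀ a : ℕ, {j : Fin n | (j : ℕ) < k ∨ a ≤ (v j : ℕ)} =
      {j : Fin n | (j : ℕ) < k ∨ a ≤ (v' j : ℕ)} := fun a =>
    (hv.isLowerSet_or a).eq_of_ncard_eq (hv'.isLowerSet_or a) (by
      rw [← (map_low_inf_high hg k a).2.1, ← (map_low_inf_high hg' k a).2.1]
      exact h.finrank_sup_eq (highSet_mem_cyclicIntervals n a))
  have hvv : v = v' := by
    have key : ∀ (j : Fin n) (a : ℕ), a ≤ (v j : ℕ) ↔ a ≤ (v' j : ℕ) := by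
      intro j a
      have h1 := Set.ext_iff.1 (hand a) j
      have h2 := Set.ext_iff.1 (hor a) j
      simp only [Set.mem_ofPred_eq] at h1 h2
      tauto
    ext j
    exact le_antisymm ((key j _).1 le_rfl) ((key j _).2 le_rfl)
  subst hvv
  refine ⟨rfl, perm_eq_of_ncard_eq fun m hm c => ?_⟩
  rcases Nat.eq_zero_or_pos m with rfl | hpos
  · simp
  let j : Fin n := ⟨m - 1, by omega⟩
  have hj : (j : ℕ) + 1 = m := by simp only [j]; omega
  rw [← finrank_map_low_inf_low hgw, ← finrank_map_low_inf_low hgw']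
  have hcmp : ∀ i : Fin n, ((i : ℕ) < k ↔ (j : ℕ) < k) → ((v j : ℕ) ≤ v i ↔ (i : ℕ) < m) := by
    intro i hi
    rcases lt_trichotomy i j with hij | rfl | hij
    · have := hv.lt_of_lt hij hi
      simp only [Fin.lt_def] at this hij
      omega
    · omega
    · have := hv.lt_of_lt hij hi.symm
      simp only [Fin.lt_def] at this hij
      omega
  by_cases hjk : (j : ℕ) < k
  · have hS : {i : Fin n | (i : ℕ) < k ∧ (v j : ℕ) ≤ (v i : ℕ)} = lowSet n m := by
      ext i
      have := hcmp i
      simp only [lowSet, Set.mem_ofPred_eq]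
      by_cases hik : (i : ℕ) < k
      · simpa [hik, hjk] using this
      · simp only [hik, false_and, false_iff]
        omega
    rw [← (map_low_inf_high hg k _).2.2.1 m hS, ← (map_low_inf_high hg' k _).2.2.1 m hS,
      inf_assoc, inf_assoc, coordSubspace_inf]
    exact h _ ⟨_, _, Or.inl rfl⟩
  · have hS : {i : Fin n | (i : ℕ) < k ∨ (v j : ℕ) ≤ (v i : ℕ)} = lowSet n m := by
      ext i
      have := hcmp i
      simp only [lowSet, Set.mem_ofPred_eq]
      by_cases hik : (i : ℕ) < k
      · simp only [hik, true_or, true_iff]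
        omega
      · simpa [hik, hjk] using this
    rw [← (map_low_inf_high hg k _).2.2.2 m hS, ← (map_low_inf_high hg' k _).2.2.2 m hS]
    have h1 := Submodule.finrank_sup_add_finrank_inf_eq
      ((coordSubspace (lowSet n k)).map g.mulVecLin ⊔ coordSubspace (highSet n (v j)))
      (coordSubspace (lowSet n c))
    have h2 := Submodule.finrank_sup_add_finrank_inf_eq
      ((coordSubspace (lowSet n k)).map g'.mulVecLin ⊔ coordSubspace (highSet n (v j)))
      (coordSubspace (lowSet n c))
    rw [sup_assoc, coordSubspace_sup] at h1 h2
    have h3 := h.finrank_sup_eq (highSet_mem_cyclicIntervals n (v j))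
    have h4 := h.finrank_sup_eq (S := highSet n (v j) ∪ lowSet n c) ⟨_, _, Or.inr rfl⟩
    omega

theorem isUnit_of_mem_doubleCoset_upper {n : ℕ} {w : Equiv.Perm (Fin n)}
    {g : Matrix (Fin n) (Fin n) ℂ}
    (hg : g ∈ doubleCoset n (upperBorel n) (permMatrix n w) (upperBorel n)) : IsUnit g := by
  obtain ⟨a, ha, b, hb, rfl⟩ := hg
  exact (ha.1.mul (isUnit_permMatrix w)).mul hb.1

/-- The image of a stratum point under a permutation matrix lies in some stratum. -/
theorem exists_map_permMatrix_mem_lusztigStratum {n k : ℕ} {v w : Equiv.Perm (Fin n)}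
    (σ : Equiv.Perm (Fin n)) {V : Submodule ℂ (Fin n → ℂ)} (hV : V ∈ lusztigStratum n k v w) :
    ∃ v' w', isMaxLengthRep n k v' ∧
      V.map (permMatrix n σ).mulVecLin ∈ lusztigStratum n k v' w' := by
  obtain ⟨g, ⟨-, hg⟩, rfl⟩ := hV
  rw [grassPoint, ← map_mulVecLin_mul]
  exact exists_mem_lusztigStratum
    ((isUnit_permMatrix σ).mul (isUnit_of_mem_doubleCoset_upper hg))

/-- If `σ` preserves cyclic intervals, its matrix maps a stratum into any stratum it meets. -/
theorem map_permMatrix_mem_lusztigStratum {n k : ℕ} {σ v w v' w' : Equiv.Perm (Fin n)}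
    (hσ : ∀ S ∈ cyclicIntervals n, σ ⁻¹' S ∈ cyclicIntervals n)
    (hv : isMaxLengthRep n k v) (hv' : isMaxLengthRep n k v')
    {V V₁ : Submodule ℂ (Fin n → ℂ)} (hV : V ∈ lusztigStratum n k v w)
    (hσV : V.map (permMatrix n σ).mulVecLin ∈ lusztigStratum n k v' w')
    (hV₁ : V₁ ∈ lusztigStratum n k v w) :
    V₁.map (permMatrix n σ).mulVecLin ∈ lusztigStratum n k v' w' := by
  obtain ⟨v₁, w₁, hv₁, hmem⟩ := exists_map_permMatrix_mem_lusztigStratum σ hV₁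
  obtain ⟨rfl, rfl⟩ := ((sameCyclicRanks_of_mem_lusztigStratum hv hV₁ hV).map_permMatrix
    hσ).perms_eq hv₁ hv' hmem hσV
  exact hmem

/-- Knutson–Lam–Speyer; Poisson-geometric proof by Yakimov.
Let `n ≥ 1`, `1 ≤ k ≤ n−1`, and let `c = (1 2 … n)` be the long cycle in `Sₙ`
(0-based on `Fin n`: `c i = i + 1` for `i + 1 < n` and `c (n−1) = 0`).  For every
`v, w ∈ Sₙ` with `v` a maximal-length coset representative and `R_{v,w} ≠ ∅`, there are
`v′, w′ ∈ Sₙ` with `v′` a maximal-length coset representative and `R_{v′,w′} ≠ ∅` such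
that `{M_c · V : V ∈ R_{v,w}} = R_{v′,w′}`: the action of the permutation matrix of the
Coxeter element `c` on `Gr(k,n)` permutes the strata of the Lusztig stratification. -/
theorem coxeter_permutes_lusztig_strata
    (n k : ℕ) (hn : 1 ≤ n) (hk1 : 1 ≤ k) (hk2 : k ≤ n - 1)
    (c : Equiv.Perm (Fin n))
    (hc : ∀ i : Fin n, (c i : ℕ) = if (i : ℕ) + 1 < n then (i : ℕ) + 1 else 0) :
    ∀ v w : Equiv.Perm (Fin n), isMaxLengthRep n k v →
      (lusztigStratum n k v w).Nonempty →
      ∃ v' w' : Equiv.Perm (Fin n), isMaxLengthRep n k v' ∧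
        (lusztigStratum n k v' w').Nonempty ∧
        (fun V : Submodule ℂ (Fin n → ℂ) => V.map (permMatrix n c).mulVecLin) ''
            lusztigStratum n k v w = lusztigStratum n k v' w' := by
  intro v w hv hne
  obtain ⟨V, hV⟩ := hne
  obtain ⟨v', w', hv', hcV⟩ := exists_map_permMatrix_mem_lusztigStratum c hV
  have hinv : ∀ (σ τ : Equiv.Perm (Fin n)) (U : Submodule ℂ (Fin n → ℂ)), σ * τ = 1 →
      (U.map (permMatrix n τ).mulVecLin).map (permMatrix n σ).mulVecLin = U := by
    intro σ τ U h
    rw [← map_mulVecLin_mul, permMatrix_mul, h, permMatrix_one, Matrix.mulVecLin_one,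
      Submodule.map_id]
  refine ⟨v', w', hv', ⟨_, hcV⟩, Set.Subset.antisymm ?_ fun U hU => ?_⟩
  · rintro _ ⟨V₁, hV₁, rfl⟩
    exact map_permMatrix_mem_lusztigStratum (fun S => preimage_mem_cyclicIntervals hc)
      hv hv' hV hcV hV₁
  · refine ⟨U.map (permMatrix n c⁻¹).mulVecLin, ?_, hinv _ _ _ (mul_inv_cancel c)⟩
    exact map_permMatrix_mem_lusztigStratum (fun S => preimage_inv_mem_cyclicIntervals hc)
      hv' hv hcV (by rwa [hinv _ _ _ (inv_mul_cancel c)]) hU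
end
end

section
/- Let n ≥ 1 and 1 ≤ k ≤ n−1. In the symmetric group S_n, let w₀ be the longest element, w₀(i) = n+1−i; let w₀^P be the longest element of S_k × S_{n−k}, i.e. w₀^P(i) = k+1−i for 1 ≤ i ≤ k and w₀^P(i) = n+k+1−i for k+1 ≤ i ≤ n; and let c be the Coxeter element, c(i) = i+1 for i < n and c(n) = 1. Then c^{gcd(k,n)} lies in the cyclic subgroup of S_n generated by w₀^P ∘ w₀. (Combined with the anti-invariance of the standard Poisson structure on a cominuscule flag variety under both w₀ and w₀^P, this shows that c^{gcd(k,n)} acts by Poisson automorphisms of (Gr(k,n), π_{k,n}); in particular when gcd(k,n) = 1 it recovers the invariance under c itself.) -/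
theorem pow_gcd_mem_zpowers_pow {G : Type*} [Group G] {g : G} {n : ℕ} (hg : g ^ n = 1) (k : ℕ) :
    g ^ Nat.gcd k n ∈ Subgroup.zpowers (g ^ k) := by
  refine Subgroup.mem_zpowers_iff.mpr ⟨Nat.gcdA k n, ?_⟩
  rw [← zpow_natCast g (Nat.gcd k n), Nat.gcd_eq_gcd_ab, zpow_add, zpow_mul, zpow_mul,
    zpow_natCast, zpow_natCast, hg, one_zpow, mul_one]

theorem val_pow_apply_of_cyclic_shift {n : ℕ} {c : Equiv.Perm (Fin n)}
    (hc : ∀ i : Fin n, (c i : ℕ) = if (i : ℕ) + 1 < n then (i : ℕ) + 1 else 0)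
    (m : ℕ) (i : Fin n) : ((c ^ m) i : ℕ) = (i + m) % n := by
  induction m with
  | zero => simp [Nat.mod_eq_of_lt i.isLt]
  | succ m ih =>
    rw [pow_succ', Equiv.Perm.mul_apply, hc, ih, ← add_assoc, ← Nat.mod_add_mod (i + m) n 1]
    have h := Nat.mod_lt ((i : ℕ) + m) i.pos
    split_ifs with h1
    · rw [Nat.mod_eq_of_lt h1]
    · rw [show ((i : ℕ) + m) % n + 1 = n by omega, Nat.mod_self]


/-- Let `n ≥ 1` and `1 ≤ k ≤ n − 1`.  In the symmetric group `Sₙ`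
(permutations of `Fin n`, identified with `{1,…,n}`), let `w₀` be the longest element
(`w₀(i) = n+1−i`; 0-based: `n−1−i`), let `w₀ᴾ` be the longest element of `S_k × S_{n−k}`
(`w₀ᴾ(i) = k+1−i` for `i ≤ k`, `w₀ᴾ(i) = n+k+1−i` for `i ≥ k+1`; 0-based: `k−1−i` resp.
`n+k−1−i`), and let `c` be the Coxeter element (`c(i) = i+1` for `i < n`, `c(n) = 1`;
0-based: `i+1` for `i+1 < n`, else `0`).  Then `c ^ gcd(k, n)` lies in the cyclic
subgroup of `Sₙ` generated by `w₀ᴾ ∘ w₀`. -/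
theorem coxeter_pow_gcd_mem_zpowers
    (n k : ℕ) (hn : 1 ≤ n) (hk1 : 1 ≤ k) (hk2 : k ≤ n - 1)
    (w₀ w₀P c : Equiv.Perm (Fin n))
    (hw₀ : ∀ i : Fin n, (w₀ i : ℕ) = n - 1 - (i : ℕ))
    (hw₀P : ∀ i : Fin n,
      (w₀P i : ℕ) = if (i : ℕ) < k then k - 1 - (i : ℕ) else n + k - 1 - (i : ℕ))
    (hc : ∀ i : Fin n, (c i : ℕ) = if (i : ℕ) + 1 < n then (i : ℕ) + 1 else 0) :
    c ^ Nat.gcd k n ∈ Subgroup.zpowers (w₀P * w₀) := by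
  have hcn : c ^ n = 1 := by
    ext i
    simp [val_pow_apply_of_cyclic_shift hc, Nat.mod_eq_of_lt i.isLt]
  have hck : w₀P * w₀ = c ^ k := by
    ext i
    rw [Equiv.Perm.mul_apply, hw₀P, hw₀, val_pow_apply_of_cyclic_shift hc]
    have hi := i.isLt
    split_ifs with h
    · rw [Nat.mod_eq_sub_mod (by omega), Nat.mod_eq_of_lt (by omega)]
      omega
    · rw [Nat.mod_eq_of_lt (by omega)]
      omega
  rw [hck]
  exact pow_gcd_mem_zpowers_pow hcn k
end
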